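/- Quantitative derivative bound for the cutoff h*: There exists a constant C > 0 such that for all real numbers r₁ < r₂ with r₂ − r₁ ≤ 1, the function H : ℝ → ℝ given by H(x) = 0 for x ≤ r₁, H(x) = 1/(1 + exp(1/(x − r₁) + 1/(x − r₂))) for r₁ < x < r₂, and H(x) = 1 for x ≥ r₂ satisfies |H'(x)| ≤ C/(r₂ − r₁)² for every x ∈ ℝ. -/

import Mathlib

/-- The `C^∞` cutoff function `h*(·, r₁, r₂)` of Section 2. -/
noncomputable def Hcut (r₁ r₂ x : ℝ) : ℝ :=
  if x ≤ r₁ then 0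
  else if x < r₂ then 1 / (1 + Real.exp (1 / (x - r₁) + 1 / (x - r₂)))
  else 1

/-- If `f` is constant on a set of unique differentiability, its derivative vanishes there. -/
lemma deriv_eq_zero_of_eqOn_const {f : ℝ → ℝ} {s : Set ℝ} {c x : ℝ}
    (hs : UniqueDiffWithinAt ℝ s x) (hx : x ∈ s) (hf : ∀ y ∈ s, f y = c) : deriv f x = 0 := by
  by_cases h : DifferentiableAt ℝ f x
  · rw [← h.derivWithin hs, derivWithin_congr hf (hf x hx)]
    simp
  · exact deriv_zero_of_not_differentiableAt h

lemma inv_sq_add_inv_sq_le_of_le {a b : ℝ} (ha : 0 < a) (hab : a ≤ b) (h1 : a + b ≤ 1) :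
    a⁻¹ ^ 2 + b⁻¹ ^ 2 ≤
      20 * (a + b)⁻¹ ^ 2 * (2 + Real.exp (a⁻¹ - b⁻¹) + Real.exp (-(a⁻¹ - b⁻¹))) := by
  have hb : 0 < b := ha.trans_le hab
  have hu : 1 ≤ (a + b)⁻¹ := (one_le_inv₀ (by positivity)).2 h1
  have ht : b⁻¹ ≤ 2 * (a + b)⁻¹ := by
    rw [← div_eq_mul_inv, inv_eq_one_div, div_le_div_iff₀ hb (by positivity)]
    linarith
  have hs0 : 0 < a⁻¹ := inv_pos.2 ha
  have ht0 : 0 < b⁻¹ := inv_pos.2 hb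
  generalize (a + b)⁻¹ = u at *
  generalize a⁻¹ = s at *
  generalize b⁻¹ = t at *
  have he1 := Real.exp_pos (s - t)
  have he2 := Real.exp_pos (-(s - t))
  have htu : t ^ 2 ≤ 4 * u ^ 2 := by nlinarith
  have hu2 : 1 ≤ u ^ 2 := by nlinarith
  rcases le_total s (4 * u) with hsu | hsu
  · have hsu2 : s ^ 2 ≤ 16 * u ^ 2 := by nlinarith
    nlinarith [mul_pos (by linarith : 0 < u ^ 2) he1, mul_pos (by linarith : 0 < u ^ 2) he2]
  · have hη : s / 2 ≤ s - t := by linarith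
    have hq := Real.quadratic_le_exp_of_nonneg (by linarith : 0 ≤ s - t)
    have hs2 : s ^ 2 ≤ 8 * Real.exp (s - t) := by nlinarith
    nlinarith [mul_le_mul_of_nonneg_right hu2 he1.le,
      mul_pos (by linarith : 0 < u ^ 2) he2]

lemma inv_sq_add_inv_sq_le {a b : ℝ} (ha : 0 < a) (hb : 0 < b) (h1 : a + b ≤ 1) :
    a⁻¹ ^ 2 + b⁻¹ ^ 2 ≤
      20 * (a + b)⁻¹ ^ 2 * (2 + Real.exp (a⁻¹ - b⁻¹) + Real.exp (-(a⁻¹ - b⁻¹))) := by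
  rcases le_total a b with h | h
  · exact inv_sq_add_inv_sq_le_of_le ha h h1
  · have := inv_sq_add_inv_sq_le_of_le hb h (by linarith)
    rw [neg_sub] at this ⊢
    rw [add_comm b a] at this
    linarith

lemma hasDerivAt_Hcut {r₁ r₂ x : ℝ} (h₁ : r₁ < x) (h₂ : x < r₂) :
    HasDerivAt (Hcut r₁ r₂)
      (((x - r₁)⁻¹ ^ 2 + (r₂ - x)⁻¹ ^ 2) /
        (2 + Real.exp ((x - r₁)⁻¹ - (r₂ - x)⁻¹) + Real.exp (-((x - r₁)⁻¹ - (r₂ - x)⁻¹)))) x := by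
  have ha : x - r₁ ≠ 0 := (sub_pos.2 h₁).ne'
  have hb : r₂ - x ≠ 0 := (sub_pos.2 h₂).ne'
  have hη : HasDerivAt (fun y => (y - r₁)⁻¹ - (r₂ - y)⁻¹)
      (-1 / (x - r₁) ^ 2 - -(-1) / (r₂ - x) ^ 2) x :=
    (((hasDerivAt_id x).sub_const r₁).fun_inv ha).sub
      (((hasDerivAt_id x).const_sub r₂).fun_inv hb)
  have hH := (hη.exp.const_add 1).fun_inv (by positivity)
  have heq : Hcut r₁ r₂ =ᶠ[nhds x] fun y => (1 + Real.exp ((y - r₁)⁻¹ - (r₂ - y)⁻¹))⁻¹ := by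
    filter_upwards [Ioo_mem_nhds h₁ h₂] with y hy
    rw [Hcut, if_neg (not_le.2 hy.1), if_pos hy.2, one_div, one_div, one_div, ← neg_sub r₂ y,
      inv_neg, ← sub_eq_add_neg]
  refine (hH.congr_of_eventuallyEq heq).congr_deriv ?_
  rw [Real.exp_neg]
  have he := Real.exp_pos ((x - r₁)⁻¹ - (r₂ - x)⁻¹)
  generalize Real.exp ((x - r₁)⁻¹ - (r₂ - x)⁻¹) = e at *
  field_simp
  ring

/-- Quantitative derivative bound for the cutoff `h*`: there is a constant `C > 0`
such that for all `r₁ < r₂` with `r₂ - r₁ ≤ 1`, the derivative of `H = h*(·, r₁, r₂)`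
satisfies `|H'(x)| ≤ C/(r₂ - r₁)²` for every `x`. -/
theorem cutoff_deriv_bound :
    ∃ C > (0 : ℝ), ∀ r₁ r₂ : ℝ, r₁ < r₂ → r₂ - r₁ ≤ 1 →
      ∀ x : ℝ, |deriv (Hcut r₁ r₂) x| ≤ C / (r₂ - r₁) ^ 2 := by
  refine ⟨20, by norm_num, fun r₁ r₂ _ hle x => ?_⟩
  rcases le_or_gt x r₁ with h₁ | h₁
  · rw [deriv_eq_zero_of_eqOn_const (f := Hcut r₁ r₂) (c := 0) (uniqueDiffOn_Iic r₁ x h₁) h₁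
      (fun y hy => if_pos hy), abs_zero]
    positivity
  rcases le_or_gt r₂ x with h₂ | h₂
  · rw [deriv_eq_zero_of_eqOn_const (f := Hcut r₁ r₂) (c := 1) (uniqueDiffOn_Ici r₂ x h₂) h₂
      (fun y hy => by
        have hy' : r₂ ≤ y := hy
        rw [Hcut, if_neg (by linarith), if_neg (by linarith)]), abs_zero]
    positivity
  have key := inv_sq_add_inv_sq_le (sub_pos.2 h₁) (sub_pos.2 h₂) (by linarith)
  rw [show x - r₁ + (r₂ - x) = r₂ - r₁ by ring] at key
  rw [(hasDerivAt_Hcut h₁ h₂).deriv, abs_of_nonneg (by positivity), div_le_iff₀ (by positivity),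
    div_eq_mul_inv, ← inv_pow]
  exact key
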